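/- Fix integers $m \ge 1$ and $d \ge 1$. Let $\mathbb{B}$ be the open unit ball in $\mathbb{R}^d$, and let $\varphi : \mathbb{R}^d \to \mathbb{R}$ be a smooth even function, compactly supported in $\mathbb{B}$, with $\int \varphi = 1$ and $\int x^\alpha \varphi(x)\,dx = 0$ for all multiindices $\alpha$ with $1 \le |\alpha| \le m-1$. For an integer $\ell \ge 0$ let $C^\ell(\mathbb{B})$ be the set of functions $f : \mathbb{B} \to \mathbb{R}$ all of whose partial derivatives $\partial^\beta f$ with $|\beta| \le \ell$ exist and are continuous and bounded on $\mathbb{B}$ (for $\ell = 0$: bounded continuous functions). For a bounded continuous function $f$ on $\mathbb{B}$, an integer $j \ge 0$, and $x, h \in \mathbb{R}^d$ with $|x| \le 1 - 2^{-j}$, define $$P_j f(x,h) := 2^{dj} \int_{\mathbb{R}^d} f(x-z) \sum_{k=0}^{m} 2^{kj}\, \frac{((h\cdot\nabla)^k \varphi)(2^j z)}{k!}\, dz,$$ where $(h\cdot\nabla)^k\varphi$ is the $k$-fold directional derivative of $\varphi$ in direction $h$, and the integrand is taken to be $0$ wherever $|2^j z| \ge 1$ (for all other $z$ one has $x - z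 \in \mathbb{B}$). Then there is a constant $C > 0$ depending only on $\varphi$, $d$ and $m$ such that for every integer $0 \le \ell \le m$, every $f \in C^\ell(\mathbb{B})$, every integer $j \ge 0$, and all $x, h \in \mathbb{R}^d$ with $|x| \le 1 - 2^{-j}$ and $|x+h| < 1$, $$|P_j f(x,h) - f(x+h)| \le C\, 2^{-j\ell}\, \bigl(1 + (2^j |h|)^m\bigr) \sup_{|\omega|<1,\ |\beta|=\ell} |\partial^\beta f(\omega)|.$$ -/

import Mathlib

open Metric MeasureTheory

/-- The mixed partial derivative of `f` (restricted to the open unit ball of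
`ℝ^d`) along the coordinate directions `σ 0, …, σ (k-1)`. For `C^k` functions
mixed partials commute, so as `σ` varies these are exactly the `∂^β f` with
`|β| = k`. -/
noncomputable def mixedPartial {d : ℕ} (k : ℕ) (σ : Fin k → Fin d)
    (f : EuclideanSpace ℝ (Fin d) → ℝ) (x : EuclideanSpace ℝ (Fin d)) : ℝ :=
  iteratedFDerivWithin ℝ k f (ball (0 : EuclideanSpace ℝ (Fin d)) 1) x
    (fun i => EuclideanSpace.single (σ i) (1 : ℝ))

/-- `f ∈ C^ℓ(𝔹)`: on the open unit ball, `f` has continuous and bounded partial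
derivatives of every order up to `ℓ`. The values of `f` off the ball are irrelevant. -/
def MemCBall {d : ℕ} (ℓ : ℕ) (f : EuclideanSpace ℝ (Fin d) → ℝ) : Prop :=
  ContDiffOn ℝ ℓ f (ball (0 : EuclideanSpace ℝ (Fin d)) 1) ∧
    ∃ B : ℝ, ∀ k : ℕ, k ≤ ℓ → ∀ σ : Fin k → Fin d,
      ∀ ω ∈ ball (0 : EuclideanSpace ℝ (Fin d)) 1, |mixedPartial k σ f ω| ≤ B

/-- `sup_{|ω| < 1, |β| = ℓ} |∂^β f(ω)|`; a genuine supremum of a bounded family for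
`f ∈ C^ℓ(𝔹)`. When `d = 0 < ℓ` there is no `β` and the value is `0`. -/
noncomputable def supPartial {d : ℕ} (ℓ : ℕ)
    (f : EuclideanSpace ℝ (Fin d) → ℝ) : ℝ :=
  ⨆ p : ball (0 : EuclideanSpace ℝ (Fin d)) 1 × (Fin ℓ → Fin d),
    |mixedPartial ℓ p.2 f p.1|

/-- The operator
`P_j f(x,h) = 2^{dj} ∫ f(x-z) Σ_{k=0}^m 2^{kj} ((h·∇)^k φ)(2^j z)/k! dz`,
where `(h·∇)^k φ` is the `k`-fold directional derivative of `φ` along `h`. -/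
noncomputable def Pj (d m : ℕ) (φ f : EuclideanSpace ℝ (Fin d) → ℝ) (j : ℕ)
    (x h : EuclideanSpace ℝ (Fin d)) : ℝ :=
  (2 : ℝ) ^ (d * j) * ∫ z : EuclideanSpace ℝ (Fin d),
    f (x - z) * ∑ k ∈ Finset.range (m + 1),
      (2 : ℝ) ^ (k * j) *
        iteratedFDeriv ℝ k φ (((2 : ℝ) ^ j) • z) (fun _ => h) /
          (Nat.factorial k)

section Calculus

variable {E : Type*} [NormedAddCommGroup E] [NormedSpace ℝ E]

/-- Taylor's theorem on a convex open set, with the remainder bounded by the size of the top-order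
directional derivative along the segment. -/
theorem abs_sub_taylor_le_of_contDiffOn {s : Set E} (hso : IsOpen s) (hsc : Convex ℝ s)
    {f : E → ℝ} {n : ℕ} (hf : ContDiffOn ℝ n f s) {x y : E} (hx : x ∈ s) (hy : y ∈ s) {M : ℝ}
    (hM : ∀ z ∈ s, |iteratedFDerivWithin ℝ n f s z (fun _ => y - x)| ≤ M) :
    |f y - ∑ k ∈ Finset.range n,
      iteratedFDerivWithin ℝ k f s x (fun _ => y - x) / (Nat.factorial k : ℝ)| ≤ M := by
  rcases n with _ | n
  · simpa using hM y hy
  let g : ℝ →ᴬ[ℝ] E := ContinuousAffineMap.lineMap x y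
  have hgmem : ∀ t ∈ Set.Icc (0 : ℝ) 1, g t ∈ s := fun t ht =>
    hsc.lineMap_mem hx hy ht
  have hg0 : g 0 = x := AffineMap.lineMap_apply_zero x y
  have hg1 : g 1 = y := AffineMap.lineMap_apply_one x y
  have hsub : Set.Icc (0 : ℝ) 1 ⊆ g ⁻¹' s := hgmem
  have hser := ((hf.ftaylorSeriesWithin hso.uniqueDiffOn).comp_continuousAffineMap g).mono hsub
  have hder : ∀ k ≤ n + 1, ∀ t ∈ Set.Icc (0 : ℝ) 1,
      iteratedDerivWithin k (f ∘ g) (Set.Icc 0 1) t =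
        iteratedFDerivWithin ℝ k f s (g t) (fun _ => y - x) := by
    intro k hk t ht
    rw [iteratedDerivWithin_eq_iteratedFDerivWithin,
      ← hser.eq_iteratedFDerivWithin_of_uniqueDiffOn (by exact_mod_cast hk)
        (uniqueDiffOn_Icc zero_lt_one) ht]
    simp [ftaylorSeriesWithin, g]
  have hcd : ContDiffOn ℝ (n + 1) (f ∘ g) (Set.Icc 0 1) := by
    have := HasFTaylorSeriesUpToOn.contDiffOn (n := ((n + 1 : ℕ) : ℕ∞)) (by exact_mod_cast hser)
    exact_mod_cast this
  have key := taylor_mean_remainder_bound (C := M) zero_le_one hcd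
    (Set.right_mem_Icc.2 zero_le_one) (fun t ht => by
      rw [hder (n + 1) le_rfl t ht, Real.norm_eq_abs]
      exact hM _ (hgmem t ht))
  rw [taylor_within_apply, Real.norm_eq_abs] at key
  have hM0 : 0 ≤ M := (abs_nonneg _).trans (hM x hx)
  have hsum : ∑ k ∈ Finset.range (n + 1), (((Nat.factorial k : ℝ))⁻¹ * ((1 : ℝ) - 0) ^ k) •
      iteratedDerivWithin k (f ∘ g) (Set.Icc 0 1) 0 = ∑ k ∈ Finset.range (n + 1),
      iteratedFDerivWithin ℝ k f s x (fun _ => y - x) / (Nat.factorial k : ℝ) := by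
    refine Finset.sum_congr rfl fun k hk => ?_
    rw [hder k (Finset.mem_range.1 hk).le 0 (Set.left_mem_Icc.2 zero_le_one), hg0]
    simp [div_eq_inv_mul]
  rw [hsum, Function.comp_apply, hg1] at key
  refine key.trans ?_
  rw [sub_zero, one_pow, mul_one]
  exact div_le_self hM0 (by exact_mod_cast Nat.factorial_pos n)

theorem iteratedFDeriv_eq_zero_of_le {f : E → ℝ} {n k : ℕ} (hnk : n ≤ k)
    (h : iteratedFDeriv ℝ n f = 0) : iteratedFDeriv ℝ k f = 0 := by
  induction k, hnk using Nat.le_induction with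
  | base => exact h
  | succ k _ ih =>
    ext x v
    rw [iteratedFDeriv_succ_apply_left, ih]
    simp

theorem eq_sum_iteratedFDeriv_of_iteratedFDeriv_eq_zero {q : E → ℝ} {n : ℕ}
    (hq : ContDiff ℝ n q) (h : iteratedFDeriv ℝ n q = 0) (y : E) :
    q y = ∑ k ∈ Finset.range n, iteratedFDeriv ℝ k q 0 (fun _ => y) / (Nat.factorial k : ℝ) := by
  have key := abs_sub_taylor_le_of_contDiffOn (M := 0) isOpen_univ convex_univ hq.contDiffOn
    (Set.mem_univ 0) (Set.mem_univ y) (fun z _ => by simp [iteratedFDerivWithin_univ, h])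
  simp only [iteratedFDerivWithin_univ, sub_zero] at key
  exact sub_eq_zero.1 (abs_nonpos_iff.1 key)

theorem iteratedFDeriv_diagonal_eq_zero {n k : ℕ} (hnk : n < k)
    (A : ContinuousMultilinearMap ℝ (fun _ : Fin n => E) ℝ) :
    iteratedFDeriv ℝ k (fun x => A (fun _ => x)) = 0 := by
  refine iteratedFDeriv_eq_zero_of_le (n := n + 1) hnk ?_
  have hc : iteratedFDeriv ℝ n (fun x => A (fun _ => x)) =
      fun _ => iteratedFDeriv ℝ n (fun x => A (fun _ => x)) 0 := by
    ext x v
    simp only [ContinuousMultilinearMap.iteratedFDeriv_comp_diagonal]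
  ext x v
  rw [iteratedFDeriv_succ_apply_left, hc]
  simp

theorem ContinuousMultilinearMap.contDiff_diagonal {n : ℕ} {r : WithTop ℕ∞}
    (A : ContinuousMultilinearMap ℝ (fun _ : Fin n => E) ℝ) :
    ContDiff ℝ r (fun x => A (fun _ => x)) :=
  A.contDiff.comp (contDiff_pi.2 fun _ => contDiff_id)

/-- The derivative of order `k` of a directional derivative. -/
theorem iteratedFDeriv_fderiv_apply {q : E → ℝ} (hq : ContDiff ℝ (⊤ : ℕ∞) q) (h : E) (k : ℕ)
    (x : E) (v : Fin k → E) :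
    iteratedFDeriv ℝ k (fun y => fderiv ℝ q y h) x v =
      iteratedFDeriv ℝ (k + 1) q x (Fin.snoc v h) := by
  rw [iteratedFDeriv_succ_apply_right]
  have hd : ContDiff ℝ (⊤ : ℕ∞) (fderiv ℝ q) := hq.fderiv_right (by norm_cast)
  have := (ContinuousLinearMap.apply ℝ ℝ h).iteratedFDeriv_comp_left (x := x) (i := k)
    (hd.contDiffAt) (by exact_mod_cast le_top)
  have h2 : (⇑(ContinuousLinearMap.apply ℝ ℝ h) ∘ fderiv ℝ q) = fun y => fderiv ℝ q y h := rfl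
  rw [h2] at this
  rw [this]
  simp

theorem contDiff_iteratedFDeriv_apply {q : E → ℝ} (hq : ContDiff ℝ (⊤ : ℕ∞) q) (k : ℕ)
    (v : Fin k → E) : ContDiff ℝ (⊤ : ℕ∞) (fun y => iteratedFDeriv ℝ k q y v) :=
  (ContinuousMultilinearMap.apply ℝ (fun _ : Fin k => E) ℝ v).contDiff.comp
    (hq.iteratedFDeriv_right (i := k) (by norm_cast))

theorem iteratedFDeriv_iteratedFDeriv_apply_eq_zero {q : E → ℝ} (hq : ContDiff ℝ (⊤ : ℕ∞) q)
    {n : ℕ} (h0 : iteratedFDeriv ℝ n q = 0) (k : ℕ) (h : E) :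
    iteratedFDeriv ℝ n (fun y => iteratedFDeriv ℝ k q y (fun _ => h)) = 0 := by
  induction k with
  | zero => simpa using h0
  | succ k ih =>
    have hs := contDiff_iteratedFDeriv_apply hq k (fun _ => h)
    have : (fun y => iteratedFDeriv ℝ (k + 1) q y (fun _ => h)) =
        fun y => fderiv ℝ (fun z => iteratedFDeriv ℝ k q z (fun _ => h)) y h := by
      ext y
      rw [DifferentiableAt.iteratedFDeriv_succ_apply_left'
        ((hq.differentiable_iteratedFDeriv (m := k) (by exact_mod_cast WithTop.coe_lt_top _)) y)]
      rfl
    rw [this]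
    ext x v
    rw [iteratedFDeriv_fderiv_apply hs, iteratedFDeriv_eq_zero_of_le (Nat.le_succ n) ih]
    simp

theorem hasCompactSupport_iteratedFDeriv_apply {φ : E → ℝ} (hφ : HasCompactSupport φ) (k : ℕ)
    (v : Fin k → E) : HasCompactSupport (fun y => iteratedFDeriv ℝ k φ y v) :=
  (hφ.iteratedFDeriv k).comp_left
    (g := fun A : ContinuousMultilinearMap ℝ (fun _ : Fin k => E) ℝ => A v) rfl

variable [FiniteDimensional ℝ E] [MeasurableSpace E] [BorelSpace E]

/-- Repeated integration by parts against a smooth compactly supported function. -/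
theorem integral_mul_iteratedFDeriv_apply (μ : Measure E) [μ.IsAddHaarMeasure] {φ q : E → ℝ}
    (hφ : ContDiff ℝ (⊤ : ℕ∞) φ) (hφc : HasCompactSupport φ) (hq : ContDiff ℝ (⊤ : ℕ∞) q)
    (k : ℕ) (h : E) :
    ∫ w, q w * iteratedFDeriv ℝ k φ w (fun _ => h) ∂μ =
      (-1) ^ k * ∫ w, iteratedFDeriv ℝ k q w (fun _ => h) * φ w ∂μ := by
  induction k generalizing q with
  | zero => simp
  | succ k ih =>
    have hψ := contDiff_iteratedFDeriv_apply hφ k (fun _ => h)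
    have hψc := hasCompactSupport_iteratedFDeriv_apply hφc k (fun _ => h)
    have hdq : ContDiff ℝ (⊤ : ℕ∞) (fun y => fderiv ℝ q y h) :=
      (hq.fderiv_right (by norm_cast)).clm_apply contDiff_const
    have hdψ : ContDiff ℝ (⊤ : ℕ∞)
        (fun y => fderiv ℝ (fun z => iteratedFDeriv ℝ k φ z (fun _ => h)) y h) :=
      (hψ.fderiv_right (by norm_cast)).clm_apply contDiff_const
    have hsucc : ∀ w, iteratedFDeriv ℝ (k + 1) φ w (fun _ => h) =
        fderiv ℝ (fun z => iteratedFDeriv ℝ k φ z (fun _ => h)) w h := fun w => by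
      rw [DifferentiableAt.iteratedFDeriv_succ_apply_left'
        ((hφ.differentiable_iteratedFDeriv (m := k) (by exact_mod_cast WithTop.coe_lt_top _)) w)]
      rfl
    simp only [hsucc]
    rw [integral_mul_fderiv_eq_neg_fderiv_mul_of_integrable, ih hdq, pow_succ]
    · simp only [iteratedFDeriv_fderiv_apply hq]
      have : (Fin.snoc (fun _ : Fin k => h) h : Fin (k + 1) → E) = fun _ => h := by
        ext i
        refine Fin.lastCases ?_ (fun j => ?_) i <;> simp
      rw [this]
      ring
    · exact (hdq.continuous.mul hψ.continuous).integrable_of_hasCompactSupport hψc.mul_left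
    · exact (hq.continuous.mul hdψ.continuous).integrable_of_hasCompactSupport
        (hψc.fderiv_apply (𝕜 := ℝ) h).mul_left
    · exact (hq.continuous.mul hψ.continuous).integrable_of_hasCompactSupport hψc.mul_left
    · exact fun x _ => hq.differentiable (by simp) x
    · exact fun x _ => hψ.differentiable (by simp) x

end Calculus

section Euclidean

variable {d : ℕ}

theorem ContinuousMultilinearMap.diagonal_eq_sum_single {n : ℕ}
    (A : ContinuousMultilinearMap ℝ (fun _ : Fin n => EuclideanSpace ℝ (Fin d)) ℝ)
    (w : EuclideanSpace ℝ (Fin d)) :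
    A (fun _ => w) = ∑ σ : Fin n → Fin d,
      (∏ i, w (σ i)) * A (fun i => EuclideanSpace.single (σ i) (1 : ℝ)) := by
  have hw : w = ∑ i, w i • EuclideanSpace.single i (1 : ℝ) := by
    simpa using ((EuclideanSpace.basisFun (Fin d) ℝ).sum_repr w).symm
  conv_lhs => rw [hw]
  rw [A.map_sum]
  refine Finset.sum_congr rfl fun σ _ => ?_
  rw [A.map_smul_univ, smul_eq_mul]

theorem integral_diagonal_mul_eq_zero {φ : EuclideanSpace ℝ (Fin d) → ℝ} {m : ℕ}
    (hφ : Continuous φ) (hφc : HasCompactSupport φ)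
    (hφmom : ∀ α : Fin d → ℕ, 1 ≤ ∑ i, α i → ∑ i, α i ≤ m - 1 →
      (∫ x : EuclideanSpace ℝ (Fin d), (∏ i, x i ^ α i) * φ x) = 0)
    {n : ℕ} (hn : 1 ≤ n) (hnm : n ≤ m - 1)
    (A : ContinuousMultilinearMap ℝ (fun _ : Fin n => EuclideanSpace ℝ (Fin d)) ℝ) :
    ∫ w, A (fun _ => w) * φ w = 0 := by
  simp only [A.diagonal_eq_sum_single, Finset.sum_mul]
  rw [integral_finsetSum]
  · refine Finset.sum_eq_zero fun σ _ => ?_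
    have hcard : ∑ i, (Finset.univ.filter fun j => σ j = i).card = n := by
      rw [← Finset.card_eq_sum_card_fiberwise (fun _ _ => Finset.mem_coe.2 (Finset.mem_univ _))]
      simp
    have hprod : ∀ w : EuclideanSpace ℝ (Fin d),
        ∏ j, w (σ j) = ∏ i, w i ^ (Finset.univ.filter fun j => σ j = i).card := fun w => by
      rw [Finset.prod_comp (fun i => w i) σ]
      refine Finset.prod_subset (Finset.subset_univ _) fun i _ hi => ?_
      rw [Finset.card_eq_zero.2, pow_zero]
      refine Finset.filter_eq_empty_iff.2 fun j _ hj => hi ?_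
      exact Finset.mem_image.2 ⟨j, Finset.mem_univ _, hj⟩
    have h0 := hφmom (fun i => (Finset.univ.filter fun j => σ j = i).card)
      (by rw [hcard]; exact hn) (by rw [hcard]; exact hnm)
    calc _ = ∫ w, A (fun i => EuclideanSpace.single (σ i) (1 : ℝ)) *
          ((∏ i, w i ^ (Finset.univ.filter fun j => σ j = i).card) * φ w) := by
          refine integral_congr_ae (Filter.Eventually.of_forall fun w => ?_)
          simp only [hprod]
          ring
      _ = 0 := by rw [integral_const_mul, h0, mul_zero]
  · intro σ _
    refine Continuous.integrable_of_hasCompactSupport ?_ hφc.mul_left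
    fun_prop

/-- A compactly supported function with unit mass whose moments of positive order `< m` vanish
integrates polynomials of degree `< m` to their value at the origin. -/
theorem integral_mul_eq_apply_zero {φ : EuclideanSpace ℝ (Fin d) → ℝ} {m : ℕ} (hm : 1 ≤ m)
    (hφ : Continuous φ) (hφc : HasCompactSupport φ)
    (hφint : (∫ x : EuclideanSpace ℝ (Fin d), φ x) = 1)
    (hφmom : ∀ α : Fin d → ℕ, 1 ≤ ∑ i, α i → ∑ i, α i ≤ m - 1 →
      (∫ x : EuclideanSpace ℝ (Fin d), (∏ i, x i ^ α i) * φ x) = 0)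
    {q : EuclideanSpace ℝ (Fin d) → ℝ} (hq : ContDiff ℝ m q) (h0 : iteratedFDeriv ℝ m q = 0) :
    ∫ w, q w * φ w = q 0 := by
  have hexp : ∀ w, q w * φ w = ∑ k ∈ Finset.range m,
      (Nat.factorial k : ℝ)⁻¹ * (iteratedFDeriv ℝ k q 0 (fun _ => w) * φ w) := fun w => by
    rw [eq_sum_iteratedFDeriv_of_iteratedFDeriv_eq_zero hq h0 w, Finset.sum_mul]
    exact Finset.sum_congr rfl fun k _ => by ring
  simp only [hexp]
  rw [integral_finsetSum]
  · rw [Finset.sum_eq_single_of_mem 0 (Finset.mem_range.2 hm)]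
    · simp [integral_const_mul, hφint]
    · intro k hk hk0
      rw [integral_const_mul, integral_diagonal_mul_eq_zero hφ hφc hφmom
        (Nat.one_le_iff_ne_zero.2 hk0) (Nat.le_sub_one_of_lt (Finset.mem_range.1 hk)), mul_zero]
  · intro k _
    refine Continuous.integrable_of_hasCompactSupport ?_ hφc.mul_left.mul_left
    exact continuous_const.mul
      ((ContinuousMultilinearMap.contDiff_diagonal (r := 0) _).continuous.mul hφ)

/-- The kernel `Σ_{k ≤ m} (h·∇)^k φ / k!` reproduces polynomials of degree `< m`. -/
theorem integral_mul_sum_iteratedFDeriv {φ : EuclideanSpace ℝ (Fin d) → ℝ} {m : ℕ} (hm : 1 ≤ m)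
    (hφ : ContDiff ℝ (⊤ : ℕ∞) φ) (hφc : HasCompactSupport φ)
    (hφint : (∫ x : EuclideanSpace ℝ (Fin d), φ x) = 1)
    (hφmom : ∀ α : Fin d → ℕ, 1 ≤ ∑ i, α i → ∑ i, α i ≤ m - 1 →
      (∫ x : EuclideanSpace ℝ (Fin d), (∏ i, x i ^ α i) * φ x) = 0)
    {q : EuclideanSpace ℝ (Fin d) → ℝ} (hq : ContDiff ℝ (⊤ : ℕ∞) q)
    (h0 : iteratedFDeriv ℝ m q = 0) (h : EuclideanSpace ℝ (Fin d)) :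
    ∫ w, q w * ∑ k ∈ Finset.range (m + 1),
      iteratedFDeriv ℝ k φ w (fun _ => h) / (Nat.factorial k : ℝ) = q (-h) := by
  have hmoment : ∀ k, ∫ w, q w * iteratedFDeriv ℝ k φ w (fun _ => h) =
      iteratedFDeriv ℝ k q 0 (fun _ => -h) := fun k => by
    rw [integral_mul_iteratedFDeriv_apply volume hφ hφc hq,
      integral_mul_eq_apply_zero hm hφ.continuous hφc hφint hφmom
        ((contDiff_iteratedFDeriv_apply hq k _).of_le (by exact_mod_cast le_top))
        (iteratedFDeriv_iteratedFDeriv_apply_eq_zero hq h0 k h)]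
    have := (iteratedFDeriv ℝ k q 0).map_smul_univ (fun _ => (-1 : ℝ)) (fun _ => h)
    simpa using this.symm
  have hexp : ∀ w, q w * ∑ k ∈ Finset.range (m + 1),
      iteratedFDeriv ℝ k φ w (fun _ => h) / (Nat.factorial k : ℝ) = ∑ k ∈ Finset.range (m + 1),
      (Nat.factorial k : ℝ)⁻¹ * (q w * iteratedFDeriv ℝ k φ w (fun _ => h)) := fun w => by
    rw [Finset.mul_sum]
    exact Finset.sum_congr rfl fun k _ => by ring
  simp only [hexp]
  rw [integral_finsetSum, eq_sum_iteratedFDeriv_of_iteratedFDeriv_eq_zero (n := m + 1)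
    (hq.of_le (by exact_mod_cast le_top)) (iteratedFDeriv_eq_zero_of_le (Nat.le_succ m) h0) (-h)]
  · refine Finset.sum_congr rfl fun k _ => ?_
    rw [integral_const_mul, hmoment, div_eq_inv_mul]
  · intro k _
    refine Continuous.integrable_of_hasCompactSupport ?_
      (hasCompactSupport_iteratedFDeriv_apply hφc k _).mul_left.mul_left
    exact continuous_const.mul
      (hq.continuous.mul (contDiff_iteratedFDeriv_apply hφ k _).continuous)

theorem supPartial_nonneg (ℓ : ℕ) (f : EuclideanSpace ℝ (Fin d) → ℝ) : 0 ≤ supPartial ℓ f :=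
  Real.iSup_nonneg fun _ => abs_nonneg _

theorem abs_mixedPartial_le_supPartial {ℓ : ℕ} {f : EuclideanSpace ℝ (Fin d) → ℝ}
    (hf : MemCBall ℓ f) (σ : Fin ℓ → Fin d) {z : EuclideanSpace ℝ (Fin d)} (hz : z ∈ ball 0 1) :
    |mixedPartial ℓ σ f z| ≤ supPartial ℓ f := by
  obtain ⟨B, hB⟩ := hf.2
  exact le_ciSup (f := fun p : ball (0 : EuclideanSpace ℝ (Fin d)) 1 × (Fin ℓ → Fin d) =>
    |mixedPartial ℓ p.2 f p.1|)
    ⟨B, by rintro _ ⟨p, rfl⟩; exact hB ℓ le_rfl p.2 p.1 p.1.2⟩ (⟨z, hz⟩, σ)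

theorem abs_iteratedFDerivWithin_diagonal_le {ℓ : ℕ} {f : EuclideanSpace ℝ (Fin d) → ℝ}
    (hf : MemCBall ℓ f) {z : EuclideanSpace ℝ (Fin d)} (hz : z ∈ ball 0 1)
    (v : EuclideanSpace ℝ (Fin d)) :
    |iteratedFDerivWithin ℝ ℓ f (ball 0 1) z (fun _ => v)| ≤
      (d : ℝ) ^ ℓ * (‖v‖ ^ ℓ * supPartial ℓ f) := by
  rw [ContinuousMultilinearMap.diagonal_eq_sum_single]
  refine (Finset.abs_sum_le_sum_abs _ _).trans ?_
  have : ∀ σ ∈ (Finset.univ : Finset (Fin ℓ → Fin d)),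
      |(∏ i, v (σ i)) * iteratedFDerivWithin ℝ ℓ f (ball 0 1) z
        (fun i => EuclideanSpace.single (σ i) (1 : ℝ))| ≤ ‖v‖ ^ ℓ * supPartial ℓ f := by
    intro σ _
    rw [abs_mul, Finset.abs_prod]
    refine mul_le_mul ?_ (abs_mixedPartial_le_supPartial hf σ hz) (abs_nonneg _) (by positivity)
    refine (Finset.prod_le_prod (fun _ _ => abs_nonneg _)
      fun i _ => PiLp.norm_apply_le v (σ i)).trans ?_
    simp
  refine (Finset.sum_le_card_nsmul _ _ _ this).trans ?_
  simp

theorem pow_le_one_add_pow {a : ℝ} (ha : 0 ≤ a) {k m : ℕ} (hkm : k ≤ m) :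
    a ^ k ≤ 1 + a ^ m := by
  rcases le_total a 1 with h | h
  · exact (pow_le_one₀ ha h).trans (le_add_of_nonneg_right (pow_nonneg ha m))
  · exact (pow_le_pow_right₀ h hkm).trans (le_add_of_nonneg_left zero_le_one)

theorem abs_sum_iteratedFDeriv_le {φ : EuclideanSpace ℝ (Fin d) → ℝ} {m : ℕ} {B : ℝ}
    (hB : ∀ k ≤ m, ∀ w, ‖iteratedFDeriv ℝ k φ w‖ ≤ B) (w h : EuclideanSpace ℝ (Fin d)) :
    |∑ k ∈ Finset.range (m + 1),
      iteratedFDeriv ℝ k φ w (fun _ => h) / (Nat.factorial k : ℝ)| ≤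
      (m + 1) * (B * (1 + ‖h‖ ^ m)) := by
  have hB0 : 0 ≤ B := (norm_nonneg _).trans (hB 0 (Nat.zero_le m) 0)
  refine (Finset.abs_sum_le_sum_abs _ _).trans ?_
  have : ∀ k ∈ Finset.range (m + 1),
      |iteratedFDeriv ℝ k φ w (fun _ => h) / (Nat.factorial k : ℝ)| ≤ B * (1 + ‖h‖ ^ m) := by
    intro k hk
    have hkm : k ≤ m := Nat.lt_succ_iff.1 (Finset.mem_range.1 hk)
    rw [abs_div, Nat.abs_cast]
    refine (div_le_self (abs_nonneg _) (by exact_mod_cast Nat.factorial_pos k)).trans ?_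
    refine ((iteratedFDeriv ℝ k φ w).le_opNorm _).trans ?_
    rw [Finset.prod_const, Finset.card_univ, Fintype.card_fin]
    exact mul_le_mul (hB k hkm w) (pow_le_one_add_pow (norm_nonneg h) hkm) (by positivity) hB0
  refine (Finset.sum_le_card_nsmul _ _ _ this).trans ?_
  simp

theorem Pj_eq_integral (m : ℕ) (φ f : EuclideanSpace ℝ (Fin d) → ℝ) (j : ℕ)
    (x h : EuclideanSpace ℝ (Fin d)) :
    Pj d m φ f j x h = ∫ w, f (x - ((2 : ℝ) ^ j)⁻¹ • w) * ∑ k ∈ Finset.range (m + 1),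
      iteratedFDeriv ℝ k φ w (fun _ => (2 : ℝ) ^ j • h) / (Nat.factorial k : ℝ) := by
  have h2 : (2 : ℝ) ^ j ≠ 0 := by positivity
  have key := Measure.integral_comp_smul (volume : Measure (EuclideanSpace ℝ (Fin d)))
    (fun w => f (x - ((2 : ℝ) ^ j)⁻¹ • w) * ∑ k ∈ Finset.range (m + 1),
      iteratedFDeriv ℝ k φ w (fun _ => (2 : ℝ) ^ j • h) / (Nat.factorial k : ℝ)) ((2 : ℝ) ^ j)
  rw [finrank_euclideanSpace_fin, abs_of_nonneg (by positivity), smul_eq_mul] at key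
  rw [Pj]
  have hint : ∀ z : EuclideanSpace ℝ (Fin d),
      f (x - z) * ∑ k ∈ Finset.range (m + 1), (2 : ℝ) ^ (k * j) *
        iteratedFDeriv ℝ k φ (((2 : ℝ) ^ j) • z) (fun _ => h) / (Nat.factorial k) =
      f (x - ((2 : ℝ) ^ j)⁻¹ • (2 : ℝ) ^ j • z) * ∑ k ∈ Finset.range (m + 1),
        iteratedFDeriv ℝ k φ ((2 : ℝ) ^ j • z) (fun _ => (2 : ℝ) ^ j • h) /
          (Nat.factorial k : ℝ) := fun z => by
    rw [inv_smul_smul₀ h2]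
    congr 1
    refine Finset.sum_congr rfl fun k _ => ?_
    have := (iteratedFDeriv ℝ k φ ((2 : ℝ) ^ j • z)).map_smul_univ
      (fun _ => (2 : ℝ) ^ j) (fun _ => h)
    rw [this]
    simp [← pow_mul, mul_comm k j]
  simp only [hint]
  rw [key, ← mul_assoc, ← pow_mul, mul_comm j d, mul_inv_cancel₀ (by positivity), one_mul]

end Euclidean

theorem exists_norm_iteratedFDeriv_le {d : ℕ} {φ : EuclideanSpace ℝ (Fin d) → ℝ}
    (hφ : ContDiff ℝ (⊤ : ℕ∞) φ) (hφc : HasCompactSupport φ) (m : ℕ) :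
    ∃ B : ℝ, ∀ k ≤ m, ∀ w, ‖iteratedFDeriv ℝ k φ w‖ ≤ B := by
  choose b hb using fun k => (hφc.iteratedFDeriv (𝕜 := ℝ) k).exists_bound_of_continuous
    (hφ.continuous_iteratedFDeriv (m := k) (by exact_mod_cast le_top))
  refine ⟨∑ k ∈ Finset.range (m + 1), |b k|, fun k hk w => ?_⟩
  refine ((hb k w).trans (le_abs_self _)).trans ?_
  exact Finset.single_le_sum (f := fun k => |b k|) (fun _ _ => abs_nonneg _)
    (Finset.mem_range.2 (Nat.lt_succ_of_le hk))

/-- Approximation estimate for the rescaled kernel, at scale `c` and with explicit constants. -/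
theorem abs_integral_sub_le {d m : ℕ} (hm : 1 ≤ m) {φ : EuclideanSpace ℝ (Fin d) → ℝ}
    (hφ : ContDiff ℝ (⊤ : ℕ∞) φ) (hφc : HasCompactSupport φ) (hφsupp : tsupport φ ⊆ ball 0 1)
    (hφint : (∫ x : EuclideanSpace ℝ (Fin d), φ x) = 1)
    (hφmom : ∀ α : Fin d → ℕ, 1 ≤ ∑ i, α i → ∑ i, α i ≤ m - 1 →
      (∫ x : EuclideanSpace ℝ (Fin d), (∏ i, x i ^ α i) * φ x) = 0)
    {B : ℝ} (hB : ∀ k ≤ m, ∀ w, ‖iteratedFDeriv ℝ k φ w‖ ≤ B)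
    {ℓ : ℕ} (hℓ : ℓ ≤ m) {f : EuclideanSpace ℝ (Fin d) → ℝ} (hf : MemCBall ℓ f)
    {c : ℝ} (hc : 0 < c) {x h : EuclideanSpace ℝ (Fin d)} (hx : ‖x‖ ≤ 1 - c)
    (hxh : ‖x + c • h‖ < 1) :
    |(∫ w, f (x - c • w) * ∑ k ∈ Finset.range (m + 1),
        iteratedFDeriv ℝ k φ w (fun _ => h) / (Nat.factorial k : ℝ)) - f (x + c • h)| ≤
      (volume.real (ball (0 : EuclideanSpace ℝ (Fin d)) 1) * ((m + 1) * B) + 1) * (d : ℝ) ^ ℓ *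
        c ^ ℓ * (1 + ‖h‖ ^ m) * supPartial ℓ f := by
  set S : EuclideanSpace ℝ (Fin d) → ℝ := fun w => ∑ k ∈ Finset.range (m + 1),
    iteratedFDeriv ℝ k φ w (fun _ => h) / (Nat.factorial k : ℝ) with hS
  set A : (n : ℕ) → ContinuousMultilinearMap ℝ
      (fun _ : Fin n => EuclideanSpace ℝ (Fin d)) ℝ := fun n =>
    ((-c) ^ n / (Nat.factorial n : ℝ)) • iteratedFDerivWithin ℝ n f (ball 0 1) x with hA
  set q : EuclideanSpace ℝ (Fin d) → ℝ := fun w => ∑ n ∈ Finset.range ℓ, A n (fun _ => w) with hq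
  have hM := supPartial_nonneg ℓ f
  have hxb : x ∈ ball (0 : EuclideanSpace ℝ (Fin d)) 1 := by
    rw [mem_ball_zero_iff]; linarith
  have hmem : ∀ w ∈ ball (0 : EuclideanSpace ℝ (Fin d)) 1, x - c • w ∈ ball 0 1 := by
    intro w hw
    rw [mem_ball_zero_iff] at hw ⊢
    have h1 : ‖c • w‖ < c := by
      rw [norm_smul, Real.norm_of_nonneg hc.le]
      nlinarith
    linarith [norm_sub_le x (c • w)]
  have hqT : ∀ w, q w = ∑ n ∈ Finset.range ℓ,
      iteratedFDerivWithin ℝ n f (ball 0 1) x (fun _ => (x - c • w) - x) /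
        (Nat.factorial n : ℝ) := fun w => by
    refine Finset.sum_congr rfl fun n _ => ?_
    have := (iteratedFDerivWithin ℝ n f (ball 0 1) x).map_smul_univ
      (fun _ => -c) (fun _ => w)
    rw [show (x - c • w) - x = (-c) • w by rw [neg_smul]; abel, this]
    simp only [hA, smul_apply, smul_eq_mul, Finset.prod_const,
      Finset.card_univ, Fintype.card_fin]
    ring
  have hrem : ∀ w, x - c • w ∈ ball (0 : EuclideanSpace ℝ (Fin d)) 1 →
      |f (x - c • w) - q w| ≤ (d : ℝ) ^ ℓ * ((c * ‖w‖) ^ ℓ * supPartial ℓ f) := fun w hw => by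
    rw [hqT w]
    refine abs_sub_taylor_le_of_contDiffOn isOpen_ball (convex_ball _ _) hf.1 hxb hw fun z hz => ?_
    refine (abs_iteratedFDerivWithin_diagonal_le hf hz _).trans (le_of_eq ?_)
    rw [sub_sub_cancel_left, norm_neg, norm_smul, Real.norm_of_nonneg hc.le]
  have hqs : ContDiff ℝ (⊤ : ℕ∞) q := ContDiff.sum fun n _ => (A n).contDiff_diagonal
  have hq0 : iteratedFDeriv ℝ m q = 0 := by
    ext w v
    rw [hq, iteratedFDeriv_fun_sum_apply fun n _ => (A n).contDiff_diagonal.contDiffAt]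
    rw [Finset.sum_eq_zero]
    · rfl
    · intro n hn
      rw [iteratedFDeriv_diagonal_eq_zero ((Finset.mem_range.1 hn).trans_le hℓ)]
      rfl
  have hSc : Continuous S := continuous_finsetSum _ fun k _ =>
    (contDiff_iteratedFDeriv_apply hφ k _).continuous.div_const _
  have hSsupp : tsupport S ⊆ tsupport φ := by
    refine closure_minimal (fun w hw => ?_) (isClosed_tsupport φ)
    by_contra hwφ
    refine hw (Finset.sum_eq_zero fun k _ => ?_)
    rw [Function.notMem_support.1 fun hk => hwφ (support_iteratedFDeriv_subset (𝕜 := ℝ) k hk)]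
    simp
  have hScc : HasCompactSupport S := hφc.of_isClosed_subset (isClosed_tsupport S) hSsupp
  have hSzero : ∀ w, w ∉ ball (0 : EuclideanSpace ℝ (Fin d)) 1 → S w = 0 := fun w hw =>
    image_eq_zero_of_notMem_tsupport fun hw' => hw (hφsupp (hSsupp hw'))
  have hfint : Integrable fun w => f (x - c • w) * S w := by
    refine Continuous.integrable_of_hasCompactSupport ?_ hScc.mul_left
    refine continuous_of_tsupport fun w hw => ?_
    have hwb : w ∈ ball (0 : EuclideanSpace ℝ (Fin d)) 1 :=
      hφsupp (hSsupp (tsupport_mul_subset_right hw))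
    have hfc : ContinuousAt f (x - c • w) :=
      hf.1.continuousOn.continuousAt (isOpen_ball.mem_nhds (hmem w hwb))
    exact (ContinuousAt.comp (g := f) (f := fun w => x - c • w) hfc (by fun_prop)).mul
      hSc.continuousAt
  have hqint : Integrable fun w => q w * S w :=
    (hqs.continuous.mul hSc).integrable_of_hasCompactSupport hScc.mul_left
  have hrepr : ∫ w, q w * S w = q (-h) :=
    integral_mul_sum_iteratedFDeriv hm hφ hφc hφint hφmom hqs hq0 h
  have hsplit : (∫ w, f (x - c • w) * S w) - f (x + c • h) =
      (∫ w, (f (x - c • w) - q w) * S w) - (f (x + c • h) - q (-h)) := by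
    simp only [sub_mul]
    rw [integral_sub hfint hqint, hrepr]
    ring
  have hpoint : |f (x + c • h) - q (-h)| ≤
      (d : ℝ) ^ ℓ * (c ^ ℓ * (1 + ‖h‖ ^ m) * supPartial ℓ f) := by
    have := hrem (-h) (by simpa using hxh)
    rw [smul_neg, sub_neg_eq_add, norm_neg, mul_pow] at this
    refine this.trans ?_
    gcongr
    exact pow_le_one_add_pow (norm_nonneg h) hℓ
  have hker : |∫ w, (f (x - c • w) - q w) * S w| ≤
      (d : ℝ) ^ ℓ * (c ^ ℓ * supPartial ℓ f) * ((m + 1) * (B * (1 + ‖h‖ ^ m))) *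
        volume.real (ball (0 : EuclideanSpace ℝ (Fin d)) 1) := by
    rw [← setIntegral_eq_integral_of_forall_compl_eq_zero
      (s := ball (0 : EuclideanSpace ℝ (Fin d)) 1) fun w hw => by rw [hSzero w hw, mul_zero],
      ← Real.norm_eq_abs]
    refine norm_setIntegral_le_of_norm_le_const measure_ball_lt_top fun w hw => ?_
    rw [norm_mul, Real.norm_eq_abs, Real.norm_eq_abs]
    refine mul_le_mul ((hrem w (hmem w hw)).trans ?_) (abs_sum_iteratedFDeriv_le hB w h)
      (abs_nonneg _) (by positivity)
    gcongr
    exact mul_le_of_le_one_right hc.le (mem_ball_zero_iff.1 hw).le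
  rw [hsplit]
  refine (abs_sub _ _).trans ((add_le_add hker hpoint).trans (le_of_eq ?_))
  ring

theorem statement_11 (d m : ℕ) (hm : 1 ≤ m)
    (φ : EuclideanSpace ℝ (Fin d) → ℝ)
    (hφsmooth : ContDiff ℝ (⊤ : ℕ∞) φ) (hφcpt : HasCompactSupport φ)
    (hφsupp : tsupport φ ⊆ ball 0 1)
    (hφeven : ∀ x, φ (-x) = φ x)
    (hφint : (∫ x : EuclideanSpace ℝ (Fin d), φ x) = 1)
    (hφmom : ∀ α : Fin d → ℕ, 1 ≤ ∑ i, α i → ∑ i, α i ≤ m - 1 →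
      (∫ x : EuclideanSpace ℝ (Fin d), (∏ i, x i ^ α i) * φ x) = 0) :
    ∃ C : ℝ, 0 < C ∧
      ∀ ℓ : ℕ, ℓ ≤ m →
        ∀ f : EuclideanSpace ℝ (Fin d) → ℝ, MemCBall ℓ f →
          ∀ j : ℕ, ∀ x h : EuclideanSpace ℝ (Fin d),
            ‖x‖ ≤ 1 - ((2 : ℝ) ^ j)⁻¹ → ‖x + h‖ < 1 →
              |Pj d m φ f j x h - f (x + h)| ≤
                C * (((2 : ℝ) ^ j)⁻¹) ^ ℓ *
                  (1 + ((2 : ℝ) ^ j * ‖h‖) ^ m) * supPartial ℓ f := by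
  obtain ⟨B, hB⟩ := exists_norm_iteratedFDeriv_le hφsmooth hφcpt m
  have hB0 : 0 ≤ B := (norm_nonneg _).trans (hB 0 (Nat.zero_le m) 0)
  refine ⟨(volume.real (ball (0 : EuclideanSpace ℝ (Fin d)) 1) * ((m + 1) * B) + 1) *
    ((d : ℝ) + 1) ^ m, by positivity, ?_⟩
  intro ℓ hℓ f hf j x h hx hxh
  have h2 : (2 : ℝ) ^ j ≠ 0 := by positivity
  have hch : ((2 : ℝ) ^ j)⁻¹ • (2 : ℝ) ^ j • h = h := inv_smul_smul₀ h2 h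
  have key := abs_integral_sub_le hm hφsmooth hφcpt hφsupp hφint hφmom hB hℓ hf
    (c := ((2 : ℝ) ^ j)⁻¹) (h := (2 : ℝ) ^ j • h) (by positivity) hx (by rwa [hch])
  rw [← Pj_eq_integral, hch, norm_smul, Real.norm_of_nonneg (by positivity)] at key
  have hM := supPartial_nonneg ℓ f
  refine key.trans ?_
  gcongr
  exact (pow_le_pow_left₀ (by positivity) (by linarith) ℓ).trans
    (pow_le_pow_right₀ (by linarith [(Nat.cast_nonneg d : (0 : ℝ) ≤ d)]) hℓ)
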